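/- arXiv:2412.15686 — 2 statements merged into one kernel-verified Lean document; each statement's English description precedes it below -/
import Mathlib

section
/- Let r ≥ 1 and work in the polynomial ring in variables x_1, …, x_r over ℚ. Let e_k denote the k-th elementary symmetric polynomial of x_1, …, x_r, and let Y be the family of the r² sums x_i + x_j over all ordered pairs (i,j) with 1 ≤ i, j ≤ r. Then the third elementary symmetric polynomial of the family Y equals (2/3)·(2r³ − 3r² − 2r + 3)·e_1³ + (4r² − 2r − 4)·e_1·e_2 + 2r·e_3. -/
open MvPolynomial

section MultisetNewton

variable {R : Type*} [CommRing R]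

theorem Multiset.esymm_cons_succ_eq (a : R) (s : Multiset R) (n : ℕ) :
    (a ::ₘ s).esymm (n + 1) = s.esymm (n + 1) + a * s.esymm n := by
  simp [Multiset.esymm, Multiset.powersetCard_cons, Multiset.map_map, Multiset.sum_map_mul_left]

theorem Multiset.esymm_one_eq_sum (s : Multiset R) : s.esymm 1 = s.sum := by
  simp [Multiset.esymm, Multiset.powersetCard_one, Multiset.map_map]

theorem Multiset.two_mul_esymm_two (s : Multiset R) :
    2 * s.esymm 2 = s.sum ^ 2 - (s.map (· ^ 2)).sum := by
  induction s using Multiset.induction_on with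
  | empty => simp [Multiset.esymm, Multiset.powersetCard_zero_right]
  | cons a s ih =>
    simp only [Multiset.esymm_cons_succ_eq a s 1, Multiset.esymm_one_eq_sum, Multiset.sum_cons,
      Multiset.map_cons]
    linear_combination ih

theorem Multiset.six_mul_esymm_three (s : Multiset R) :
    6 * s.esymm 3 =
      s.sum ^ 3 - 3 * s.sum * (s.map (· ^ 2)).sum + 2 * (s.map (· ^ 3)).sum := by
  induction s using Multiset.induction_on with
  | empty => simp [Multiset.esymm, Multiset.powersetCard_zero_right]
  | cons a s ih =>
    simp only [Multiset.esymm_cons_succ_eq a s 2, Multiset.sum_cons, Multiset.map_cons]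
    linear_combination ih + 3 * a * Multiset.two_mul_esymm_two s

end MultisetNewton

section PairSums

variable {ι R : Type*} [Fintype ι] [CommRing R]

theorem sum_pair_add (x : ι → R) :
    ∑ p : ι × ι, (x p.1 + x p.2) = 2 * Fintype.card ι * ∑ i, x i := by
  simp only [Fintype.sum_prod_type, Finset.sum_add_distrib, Finset.sum_const, Finset.card_univ,
    nsmul_eq_mul, ← Finset.mul_sum]
  ring

theorem sum_pair_add_sq (x : ι → R) :
    ∑ p : ι × ι, (x p.1 + x p.2) ^ 2 =
      2 * Fintype.card ι * ∑ i, x i ^ 2 + 2 * (∑ i, x i) ^ 2 := by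
  simp only [Fintype.sum_prod_type, add_sq, Finset.sum_add_distrib, Finset.sum_const,
    Finset.card_univ, nsmul_eq_mul, ← Finset.mul_sum, ← Finset.sum_mul]
  ring

theorem sum_pair_add_cube (x : ι → R) :
    ∑ p : ι × ι, (x p.1 + x p.2) ^ 3 =
      2 * Fintype.card ι * ∑ i, x i ^ 3 + 6 * (∑ i, x i) * ∑ i, x i ^ 2 := by
  have cube_add (a b : R) : (a + b) ^ 3 = a ^ 3 + 3 * (a ^ 2 * b) + 3 * (a * b ^ 2) + b ^ 3 := by
    ring
  simp only [Fintype.sum_prod_type, cube_add, Finset.sum_add_distrib, Finset.sum_const,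
    Finset.card_univ, nsmul_eq_mul, ← Finset.mul_sum, ← Finset.sum_mul]
  ring

/-- The third elementary symmetric function of all pairwise sums `x i + x j`, with denominators
cleared. -/
theorem six_mul_esymm_three_pair_add (x : ι → R) :
    6 * ((Finset.univ : Finset (ι × ι)).val.map (fun p => x p.1 + x p.2)).esymm 3 =
      4 * (2 * (Fintype.card ι : R) ^ 3 - 3 * (Fintype.card ι : R) ^ 2 - 2 * Fintype.card ι + 3) *
          ((Finset.univ : Finset ι).val.map x).esymm 1 ^ 3 +
        6 * (4 * (Fintype.card ι : R) ^ 2 - 2 * Fintype.card ι - 4) *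
          (((Finset.univ : Finset ι).val.map x).esymm 1 *
            ((Finset.univ : Finset ι).val.map x).esymm 2) +
        12 * Fintype.card ι * ((Finset.univ : Finset ι).val.map x).esymm 3 := by
  have hY := Multiset.six_mul_esymm_three
    ((Finset.univ : Finset (ι × ι)).val.map (fun p => x p.1 + x p.2))
  have h2 := Multiset.two_mul_esymm_two ((Finset.univ : Finset ι).val.map x)
  have h3 := Multiset.six_mul_esymm_three ((Finset.univ : Finset ι).val.map x)
  simp only [Multiset.map_map, Function.comp_def, Finset.sum_map_val] at hY h2 h3
  rw [sum_pair_add, sum_pair_add_sq, sum_pair_add_cube] at hY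
  rw [hY, Multiset.esymm_one_eq_sum, Finset.sum_map_val]
  linear_combination
    -3 * (4 * (Fintype.card ι : R) ^ 2 - 2 * Fintype.card ι - 4) * (∑ i, x i) * h2 -
      2 * (Fintype.card ι : R) * h3

end PairSums

/-- Splitting-principle content of Lemma A.1(iii): if `Y` is the family of the `r²`
sums `xᵢ + xⱼ` over all ordered pairs `(i,j)`, then the third elementary symmetric
polynomial of `Y` equals `(2/3)(2r³ − 3r² − 2r + 3)·e₁³ + (4r² − 2r − 4)·e₁·e₂ + 2r·e₃`. -/
theorem stmt_8 (r : ℕ) (hr : 1 ≤ r) :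
    (((Finset.univ : Finset (Fin r × Fin r)).val.map
        (fun p => (X p.1 + X p.2 : MvPolynomial (Fin r) ℚ))).esymm 3) =
      ((2 / 3 : ℚ) * (2 * (r : ℚ) ^ 3 - 3 * (r : ℚ) ^ 2 - 2 * r + 3)) •
          (esymm (Fin r) ℚ 1) ^ 3 +
        (4 * (r : ℚ) ^ 2 - 2 * r - 4) • (esymm (Fin r) ℚ 1 * esymm (Fin r) ℚ 2) +
        (2 * (r : ℚ)) • esymm (Fin r) ℚ 3 := by
  have h := six_mul_esymm_three_pair_add (X : Fin r → MvPolynomial (Fin r) ℚ)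
  simp only [← esymm_eq_multiset_esymm, Fintype.card_fin] at h
  have h6 : (6 : MvPolynomial (Fin r) ℚ) ≠ 0 := by norm_num
  apply mul_left_cancel₀ h6
  rw [h]
  have hC : (6 : MvPolynomial (Fin r) ℚ) * C (2 / 3) = 4 := by
    rw [← map_ofNat C 6, ← C_mul, ← map_ofNat C 4]
    norm_num
  simp only [smul_eq_C_mul, map_mul, map_add, map_sub, map_pow, map_natCast, map_ofNat]
  linear_combination
    -(2 * (r : MvPolynomial (Fin r) ℚ) ^ 3 - 3 * (r : MvPolynomial (Fin r) ℚ) ^ 2 - 2 * r + 3) *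
      esymm (Fin r) ℚ 1 ^ 3 * hC
end

section
/- Let r ≥ 1 and work in the polynomial ring in variables x_1, …, x_r over ℚ. Let e_k denote the k-th elementary symmetric polynomial of x_1, …, x_r, and let Y be the family of the binom(r+2,3) sums x_i + x_j + x_k over triples with 1 ≤ i ≤ j ≤ k ≤ r. Then the second elementary symmetric polynomial of the family Y equals (1/8)·(r−1)(r+2)(r² + 5r + 8)·e_1² + (1/2)·(r+2)(r+3)·e_2. -/
open MvPolynomial

namespace Multiset

/-- Newton's identity in degree two. -/
theorem two_mul_esymm_two_s13 {R : Type*} [CommRing R] (s : Multiset R) :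
    2 * s.esymm 2 = s.sum ^ 2 - (s.map (· ^ 2)).sum := by
  induction s using Multiset.induction with
  | empty => simp [esymm, powersetCard_zero_right]
  | cons a s ih =>
    have h : (a ::ₘ s).esymm 2 = s.esymm 2 + a * s.sum := by
      simpa [esymm, powersetCard_cons, powersetCard_one, Function.comp_def] using
        sum_map_mul_left (s := s) (a := a) (f := id)
    rw [h, mul_add, ih]
    simp only [sum_cons, map_cons]
    ring

end Multiset

section OrderedSums

variable {R : Type*} [CommRing R]

theorem Fin.sum_pairs_le_add {r : ℕ} (a : R) (x : Fin r → R) :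
    2 * ∑ j, ∑ k, (if j ≤ k then a + x j + x k else 0) =
      r * (r + 1) * a + 2 * (r + 1) * ∑ i, x i := by
  induction r with
  | zero => simp
  | succ r ih =>
    have h := ih (fun i => x i.succ)
    simp only [Fin.sum_univ_succ, Fin.succ_le_succ_iff, Fin.zero_le, if_true, Fin.le_zero_iff,
      Fin.succ_ne_zero, if_false, mul_add, Finset.sum_add_distrib, Finset.sum_const,
      Finset.card_univ, Fintype.card_fin, nsmul_eq_mul, Nat.cast_succ] at h ⊢
    linear_combination h

theorem Fin.sum_pairs_le_add_sq {r : ℕ} (a : R) (x : Fin r → R) :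
    2 * ∑ j, ∑ k, (if j ≤ k then (a + x j + x k) ^ 2 else 0) =
      r * (r + 1) * a ^ 2 + 4 * (r + 1) * a * ∑ i, x i +
        2 * (r + 2) * ∑ i, x i ^ 2 + 2 * (∑ i, x i) ^ 2 := by
  induction r with
  | zero => simp
  | succ r ih =>
    have h := ih (fun i => x i.succ)
    have h1 (b : R) : ∑ k : Fin r, (b + x k.succ) ^ 2 =
        r * b ^ 2 + 2 * b * ∑ k : Fin r, x k.succ + ∑ k : Fin r, x k.succ ^ 2 := by
      simp [add_sq, Finset.sum_add_distrib, Finset.mul_sum]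
    simp only [Fin.sum_univ_succ, Fin.succ_le_succ_iff, Fin.zero_le, if_true, Fin.le_zero_iff,
      Fin.succ_ne_zero, if_false, zero_add, h1, Nat.cast_succ] at h ⊢
    linear_combination h

theorem Fin.sum_triples_le_add {r : ℕ} (x : Fin r → R) :
    2 * ∑ i, ∑ j, ∑ k, (if i ≤ j ∧ j ≤ k then x i + x j + x k else 0) =
      (r + 1) * (r + 2) * ∑ i, x i := by
  induction r with
  | zero => simp
  | succ r ih =>
    have h := ih (fun i => x i.succ)
    have h2 := Fin.sum_pairs_le_add (x 0) x
    rw [Fin.sum_univ_succ]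
    simp only [Fin.zero_le, true_and]
    rw [mul_add, h2]
    simp only [Fin.sum_univ_succ, Fin.succ_le_succ_iff, Fin.zero_le, Fin.le_zero_iff,
      Fin.succ_ne_zero, false_and, and_false, if_false, zero_add, Finset.sum_const_zero,
      Nat.cast_succ] at h ⊢
    linear_combination h

theorem Fin.sum_triples_le_add_sq {r : ℕ} (x : Fin r → R) :
    2 * ∑ i, ∑ j, ∑ k, (if i ≤ j ∧ j ≤ k then (x i + x j + x k) ^ 2 else 0) =
      (r + 2) * (r + 3) * ∑ i, x i ^ 2 + 2 * (r + 2) * (∑ i, x i) ^ 2 := by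
  induction r with
  | zero => simp
  | succ r ih =>
    have h := ih (fun i => x i.succ)
    have h2 := Fin.sum_pairs_le_add_sq (x 0) x
    rw [Fin.sum_univ_succ]
    simp only [Fin.zero_le, true_and]
    rw [mul_add, h2]
    simp only [Fin.sum_univ_succ, Fin.succ_le_succ_iff, Fin.zero_le, Fin.le_zero_iff,
      Fin.succ_ne_zero, false_and, and_false, if_false, zero_add, Finset.sum_const_zero,
      Nat.cast_succ] at h ⊢
    linear_combination h

end OrderedSums

/-- Splitting-principle content of Lemma A.5(ii): if `Y` is the family of the
`binom(r+2,3)` sums `xᵢ + xⱼ + xₖ` over triples with `i ≤ j ≤ k`, then the second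
elementary symmetric polynomial of `Y` equals
`(1/8)(r−1)(r+2)(r² + 5r + 8)·e₁² + (1/2)(r+2)(r+3)·e₂`. -/
theorem stmt_13 (r : ℕ) (hr : 1 ≤ r) :
    ((((Finset.univ : Finset (Fin r × Fin r × Fin r)).filter
          (fun p => p.1 ≤ p.2.1 ∧ p.2.1 ≤ p.2.2)).val.map
        (fun p => (X p.1 + X p.2.1 + X p.2.2 : MvPolynomial (Fin r) ℚ))).esymm 2) =
      ((1 / 8 : ℚ) * ((r : ℚ) - 1) * ((r : ℚ) + 2) * ((r : ℚ) ^ 2 + 5 * r + 8)) •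
          (esymm (Fin r) ℚ 1) ^ 2 +
        ((1 / 2 : ℚ) * ((r : ℚ) + 2) * ((r : ℚ) + 3)) • esymm (Fin r) ℚ 2 := by
  have hY := Multiset.two_mul_esymm_two_s13
    (((Finset.univ : Finset (Fin r × Fin r × Fin r)).filter
      (fun p => p.1 ≤ p.2.1 ∧ p.2.1 ≤ p.2.2)).val.map
        (fun p => (X p.1 + X p.2.1 + X p.2.2 : MvPolynomial (Fin r) ℚ)))
  have hX := Multiset.two_mul_esymm_two_s13
    ((Finset.univ : Finset (Fin r)).val.map (X : Fin r → MvPolynomial (Fin r) ℚ))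
  rw [← esymm_eq_multiset_esymm] at hX
  simp only [Multiset.map_map, Function.comp_def, Finset.sum_map_val] at hX
  simp only [Multiset.map_map, Function.comp_def, Finset.sum_map_val, Finset.sum_filter,
    Fintype.sum_prod_type] at hY
  have h1 := Fin.sum_triples_le_add (X : Fin r → MvPolynomial (Fin r) ℚ)
  have h2 := Fin.sum_triples_le_add_sq (X : Fin r → MvPolynomial (Fin r) ℚ)
  rw [esymm_one]
  set p := ∑ i : Fin r, (X i : MvPolynomial (Fin r) ℚ)
  set q := ∑ i : Fin r, (X i : MvPolynomial (Fin r) ℚ) ^ 2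
  set A := ∑ i : Fin r, ∑ j : Fin r, ∑ k : Fin r,
    (if i ≤ j ∧ j ≤ k then (X i + X j + X k : MvPolynomial (Fin r) ℚ) else 0)
  have h8 : (8 : MvPolynomial (Fin r) ℚ) ≠ 0 := by norm_num
  have hc : (8 : MvPolynomial (Fin r) ℚ) * C (1 / 8) = 1 := by
    rw [show (8 : MvPolynomial (Fin r) ℚ) = C 8 from (map_ofNat C 8).symm, ← C_mul]
    norm_num
  have hc2 : (2 : MvPolynomial (Fin r) ℚ) * C (1 / 2) = 1 := by
    rw [show (2 : MvPolynomial (Fin r) ℚ) = C 2 from (map_ofNat C 2).symm, ← C_mul]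
    norm_num
  apply mul_left_cancel₀ h8
  simp only [smul_eq_C_mul, map_mul, map_add, map_sub, map_pow, map_natCast, map_ofNat, map_one]
  set c := (r : MvPolynomial (Fin r) ℚ)
  linear_combination 4 * hY + (2 * A + (c + 1) * (c + 2) * p) * h1 - 2 * h2
    - 2 * (c + 2) * (c + 3) * hX - (c - 1) * (c + 2) * (c ^ 2 + 5 * c + 8) * p ^ 2 * hc
    - 4 * (c + 2) * (c + 3) * esymm (Fin r) ℚ 2 * hc2
end
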